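/- arXiv:1402.5904 — 3 statements merged into one kernel-verified Lean document; each statement's English description precedes it below -/
import Mathlib

section
/- Let d : ℕ → ℝ be a function with d(n) → ∞ and d(n)/n → 0 as n → ∞. Then the integrality ratio of the subtour LP for the instances G(n, d(n)) converges to 4/3 as n → ∞; that is, the quotient (length of a shortest TSP tour of G(n, d(n))) / (optimum value of the subtour LP for G(n, d(n))) tends to 4/3. -/
open Real Filter Finset

noncomputable section

/-- Euclidean distance between two points of the plane. -/
def eucl (p q : ℝ × ℝ) : ℝ := Real.sqrt ((p.1 - q.1) ^ 2 + (p.2 - q.2) ^ 2)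

/-- The points of the Euclidean TSP instance `G(n,d)`: the `3n` points
`(i, j·d)` for `i = 1,…,n` and `j = 1,2,3`, indexed by `Fin n × Fin 3`. -/
def pt (n : ℕ) (d : ℝ) (p : Fin n × Fin 3) : ℝ × ℝ :=
  ((p.1.val : ℝ) + 1, ((p.2.val : ℝ) + 1) * d)

/-- A TSP tour of `G(n,d)`: a cyclic listing of all `3n` points (a Hamiltonian
cycle), given as a sequence `t` that hits every point exactly once in
positions `0,…,3n−1` and returns to its start at position `3n`. -/
def IsTour (n : ℕ) (t : ℕ → Fin n × Fin 3) : Prop :=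
  Function.Bijective (fun i : Fin (3 * n) => t i) ∧ t (3 * n) = t 0

/-- The length of a TSP tour: the sum of the Euclidean distances between
consecutive points of the cycle. -/
def tourLength (n : ℕ) (d : ℝ) (t : ℕ → Fin n × Fin 3) : ℝ :=
  ∑ i ∈ Finset.range (3 * n), eucl (pt n d (t i)) (pt n d (t (i + 1)))

/-- Feasibility for the subtour LP on the points of `G(n,d)`, with symmetric
edge variables `x i j`: degree constraints `∑_{j≠i} x i j = 2`, subtour
elimination constraints (each unordered pair is counted twice in the double
sum, whence the factor 2), and `0 ≤ x i j ≤ 1`. -/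
def SubtourLPFeasible (n : ℕ) (x : Fin n × Fin 3 → Fin n × Fin 3 → ℝ) : Prop :=
  (∀ i j, x i j = x j i) ∧
  (∀ i, x i i = 0) ∧
  (∀ i j, 0 ≤ x i j ∧ x i j ≤ 1) ∧
  (∀ i, ∑ j, x i j = 2) ∧
  (∀ S : Finset (Fin n × Fin 3), S.Nonempty → S ≠ Finset.univ →
      ∑ i ∈ S, ∑ j ∈ S, x i j ≤ 2 * ((S.card : ℝ) - 1))

/-- The objective value of the subtour LP for `G(n,d)`: each unordered pair
appears twice in the double sum, whence the factor `1/2`. -/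
def lpValue (n : ℕ) (d : ℝ) (x : Fin n × Fin 3 → Fin n × Fin 3 → ℝ) : ℝ :=
  (1 / 2) * ∑ i, ∑ j, eucl (pt n d i) (pt n d j) * x i j

/-- The length of a shortest TSP tour of `G(n,d)`. -/
def optTour (n : ℕ) (d : ℝ) : ℝ :=
  sInf {L | ∃ t, IsTour n t ∧ tourLength n d t = L}

/-- The optimum value of the subtour LP for `G(n,d)`. -/
def optLP (n : ℕ) (d : ℝ) : ℝ :=
  sInf {L | ∃ x, SubtourLPFeasible n x ∧ lpValue n d x = L}

/-- `zcost d z` is the length of a z-shaped path covering `z` points in the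
middle row of `G(n,d)`. -/
def zcost (d x : ℝ) : ℝ := 2 * (x - 1) + Real.sqrt ((x - 1) ^ 2 + d ^ 2)

section ClosedWalk

/-- The number of steps `e < N` of a sequence of propositions at which the truth value changes. -/
def changes (N : ℕ) (s : ℕ → Prop) [DecidablePred s] : ℕ :=
  ∑ e ∈ range N, if (s e ↔ s (e + 1)) then 0 else 1

lemma even_changes_iff (N : ℕ) (s : ℕ → Prop) [DecidablePred s] :
    Even (changes N s) ↔ (s 0 ↔ s N) := by
  induction N with
  | zero => simp [changes]
  | succ k ih =>
    have h : changes (k + 1) s = changes k s + if (s k ↔ s (k + 1)) then 0 else 1 := by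
      simp [changes, sum_range_succ]
    rw [h]
    split_ifs with hk
    · rw [add_zero, ih, hk]
    · rw [Nat.even_add_one, ih]
      tauto

lemma iff_of_changes_eq_zero {N : ℕ} {s : ℕ → Prop} [DecidablePred s] (h : changes N s = 0)
    {k : ℕ} (hk : k ≤ N) : s k ↔ s 0 := by
  induction k with
  | zero => rfl
  | succ k ih =>
    have h' := (Finset.sum_eq_zero_iff.mp h) k (mem_range.mpr hk)
    rw [← ih (by omega)]
    by_contra hne
    rw [if_neg (by tauto)] at h'
    exact one_ne_zero h'

/-- A closed walk that meets both a set and its complement crosses the boundary at least twice. -/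
lemma two_le_changes {N : ℕ} {s : ℕ → Prop} [DecidablePred s] (hclosed : s N ↔ s 0)
    {a b : ℕ} (ha : a ≤ N) (hb : b ≤ N) (hsa : s a) (hsb : ¬ s b) : 2 ≤ changes N s := by
  obtain ⟨k, hk⟩ := (even_changes_iff N s).mpr hclosed.symm
  have h0 : changes N s ≠ 0 := fun h =>
    hsb (((iff_of_changes_eq_zero h ha).trans (iff_of_changes_eq_zero h hb).symm).mp hsa)
  omega

end ClosedWalk

/-- If between any two elements of `T` there is an element of `D`, then `T` has at most one
element more than `D`. -/
lemma card_le_card_succ_of_separated (T D : Finset ℕ)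
    (h : ∀ a ∈ T, ∀ b ∈ T, a < b → ∃ c ∈ D, a < c ∧ c ≤ b) : #T ≤ #D + 1 := by
  have hlt : ∀ a ∈ T, ∀ b ∈ T, a < b → #{c ∈ D | c ≤ a} < #{c ∈ D | c ≤ b} := by
    intro a ha b hb hab
    obtain ⟨c, hc, hac, hcb⟩ := h a ha b hb hab
    refine card_lt_card ((ssubset_iff_of_subset ?_).mpr ⟨c, ?_, ?_⟩)
    · intro x hx
      simp only [mem_filter] at hx ⊢
      exact ⟨hx.1, by omega⟩
    · simp [hc, hcb]
    · simp [hac]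
  rw [← card_range (#D + 1)]
  refine card_le_card_of_injOn (fun a => #{c ∈ D | c ≤ a}) ?_ ?_
  · intro a _
    simpa [Nat.lt_succ_iff] using card_filter_le D (· ≤ a)
  · intro a ha b hb hab
    rcases lt_trichotomy a b with hl | hl | hl
    · exact absurd hab (hlt a ha b hb hl).ne
    · exact hl
    · exact absurd hab (hlt b hb a ha hl).ne'

lemma convex_comb_le_sqrt {ε H D X Y : ℝ} (h0 : 0 ≤ ε) (h1 : ε ≤ 1) (hX : H ^ 2 ≤ X)
    (hY : D ^ 2 ≤ Y) : (1 - ε) * H + ε * D ≤ Real.sqrt (X + Y) := by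
  apply Real.le_sqrt_of_sq_le
  nlinarith [mul_nonneg (mul_nonneg h0 (sub_nonneg.mpr h1)) (sq_nonneg (H - D)),
    mul_nonneg h0 (sq_nonneg H), mul_nonneg (sub_nonneg.mpr h1) (sq_nonneg D)]

/-! ### Lower bound for tours -/

section TourLower

variable {n : ℕ}

lemma IsTour.exists_index {t : ℕ → Fin n × Fin 3} (ht : IsTour n t) (p : Fin n × Fin 3) :
    ∃ e ≤ 3 * n, t e = p := by
  obtain ⟨e, he⟩ := ht.1.2 p
  exact ⟨e, e.2.le, he⟩

lemma IsTour.two_le_changes {t : ℕ → Fin n × Fin 3} (ht : IsTour n t) (P : Fin n × Fin 3 → Prop)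
    [DecidablePred P] {p q : Fin n × Fin 3} (hp : P p) (hq : ¬ P q) :
    2 ≤ changes (3 * n) (fun e => P (t e)) := by
  obtain ⟨a, ha, rfl⟩ := ht.exists_index p
  obtain ⟨b, hb, rfl⟩ := ht.exists_index q
  exact _root_.two_le_changes (by rw [ht.2]) ha hb hp hq

/-- The number of steps of `t` crossing the vertical line just right of column `i`. -/
def crossings (t : ℕ → Fin n × Fin 3) (i : ℕ) : ℕ :=
  changes (3 * n) (fun e => (t e).1.val ≤ i)

lemma IsTour.even_crossings {t : ℕ → Fin n × Fin 3} (ht : IsTour n t) (i : ℕ) :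
    Even (crossings t i) :=
  (even_changes_iff _ _).mpr (by rw [ht.2])

lemma IsTour.two_le_crossings {t : ℕ → Fin n × Fin 3} (ht : IsTour n t) {i : ℕ}
    (hi : i < n - 1) : 2 ≤ crossings t i :=
  ht.two_le_changes (fun p => p.1.val ≤ i) (p := (⟨0, by omega⟩, 0))
    (q := (⟨n - 1, by omega⟩, 0)) (Nat.zero_le _) (by simp; omega)

/-- The steps of `t` that change the row. -/
def rowChanges (t : ℕ → Fin n × Fin 3) : Finset ℕ :=
  {e ∈ range (3 * n) | (t e).2 ≠ (t (e + 1)).2}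

/-- The columns containing an endpoint of a step that changes the row. -/
def rowChangeColumns (t : ℕ → Fin n × Fin 3) : Finset ℕ :=
  (rowChanges t).image (fun e => (t e).1.val) ∪ (rowChanges t).image (fun e => (t (e + 1)).1.val)

lemma card_rowChangeColumns_le (t : ℕ → Fin n × Fin 3) :
    #(rowChangeColumns t) ≤ 2 * #(rowChanges t) :=
  (card_union_le _ _).trans (by rw [two_mul]; exact add_le_add card_image_le card_image_le)

/-- Two lines enclosing only columns whose edges are all horizontal are crossed at least six
times in total. -/
lemma IsTour.six_le_crossings_add {t : ℕ → Fin n × Fin 3} (ht : IsTour n t) {a b : ℕ}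
    (hab : a < b) (hb : b < n - 1) (hclean : ∀ c ∈ rowChangeColumns t, a < c → ¬ c ≤ b) :
    6 ≤ crossings t a + crossings t b := by
  have hrow : ∀ j : Fin 3, 2 ≤ changes (3 * n)
      (fun e => (t e).2 = j ∧ a < (t e).1.val ∧ (t e).1.val ≤ b) := fun j =>
    ht.two_le_changes (fun p => p.2 = j ∧ a < p.1.val ∧ p.1.val ≤ b) (p := (⟨b, by omega⟩, j))
      (q := (⟨n - 1, by omega⟩, j)) ⟨rfl, hab, le_rfl⟩ (by simp; omega)
  have hsum : ∑ j : Fin 3, changes (3 * n)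
      (fun e => (t e).2 = j ∧ a < (t e).1.val ∧ (t e).1.val ≤ b)
      ≤ crossings t a + crossings t b := by
    unfold crossings changes
    rw [sum_comm, ← sum_add_distrib]
    refine sum_le_sum fun e he => ?_
    set K := (if ((t e).1.val ≤ a ↔ (t (e + 1)).1.val ≤ a) then 0 else 1) +
      (if ((t e).1.val ≤ b ↔ (t (e + 1)).1.val ≤ b) then 0 else 1) with hK
    have hj : ∀ j : Fin 3, (if ((t e).2 = j ∧ a < (t e).1.val ∧ (t e).1.val ≤ b ↔
        (t (e + 1)).2 = j ∧ a < (t (e + 1)).1.val ∧ (t (e + 1)).1.val ≤ b) then 0 else 1)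
        ≤ if (t e).2 = j then K else 0 := by
      intro j
      by_cases hr : (t e).2 = (t (e + 1)).2
      · rw [← hr]
        by_cases hj : (t e).2 = j
        · simp only [hj, true_and, if_true, hK]
          split_ifs <;> omega
        · simp [hj]
      · have he' : e ∈ rowChanges t := by simp [rowChanges, hr, mem_range.mp he]
        have h1 := hclean (t e).1.val (mem_union_left _ (mem_image_of_mem _ he'))
        have h2 := hclean (t (e + 1)).1.val (mem_union_right _
          (mem_image_of_mem (fun e => (t (e + 1)).1.val) he'))
        rw [if_pos (by tauto)]
        exact Nat.zero_le _
    refine (sum_le_sum fun j _ => hj j).trans ?_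
    simp
  have h6 : ∑ _j : Fin 3, 2 ≤ ∑ j : Fin 3, changes (3 * n)
      (fun e => (t e).2 = j ∧ a < (t e).1.val ∧ (t e).1.val ≤ b) :=
    sum_le_sum fun j _ => hrow j
  simp only [sum_const, card_univ, Fintype.card_fin, smul_eq_mul] at h6
  omega

lemma IsTour.sum_crossings {t : ℕ → Fin n × Fin 3} (ht : IsTour n t) :
    4 * (n - 1) ≤ ∑ i ∈ range (n - 1), crossings t i + 4 * #(rowChanges t) + 2 := by
  set T := {i ∈ range (n - 1) | crossings t i < 4} with hT
  have hcard : #T ≤ #(rowChangeColumns t) + 1 := by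
    refine card_le_card_succ_of_separated _ _ fun a ha b hb hab => ?_
    by_contra! hcon
    simp only [hT, mem_filter, mem_range] at ha hb
    have h6 := ht.six_le_crossings_add hab hb.1 fun c hc hac => not_le.mpr (hcon c hc hac)
    obtain ⟨k, hk⟩ := ht.even_crossings a
    obtain ⟨l, hl⟩ := ht.even_crossings b
    omega
  have hpt : ∑ _i ∈ range (n - 1), 4 ≤
      ∑ i ∈ range (n - 1), (crossings t i + 2 * if crossings t i < 4 then 1 else 0) := by
    refine sum_le_sum fun i hi => ?_
    have := ht.two_le_crossings (mem_range.mp hi)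
    split_ifs <;> omega
  rw [sum_add_distrib, ← mul_sum, ← card_filter, ← hT] at hpt
  simp only [sum_const, card_range, smul_eq_mul] at hpt
  have := card_rowChangeColumns_le t
  omega

lemma sum_crossing_indicator_le (N x y : ℕ) :
    ((∑ i ∈ range N, if (x ≤ i ↔ y ≤ i) then 0 else 1 : ℕ) : ℝ) ≤ |(x : ℝ) - y| := by
  have h : (∑ i ∈ range N, if (x ≤ i ↔ y ≤ i) then 0 else 1) ≤ max x y - min x y := by
    rw [← Nat.card_Ico, card_eq_sum_ones,
      ← sum_filter_not_add_sum_filter _ (fun i => (x ≤ i ↔ y ≤ i))]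
    rw [sum_congr rfl (g := fun _ => 1) (fun i hi => if_neg (mem_filter.mp hi).2),
      sum_eq_zero (s := filter (fun i => (x ≤ i ↔ y ≤ i)) _) (fun i hi => if_pos (mem_filter.mp hi).2),
      add_zero]
    refine sum_le_sum_of_subset fun i hi => ?_
    simp only [mem_filter, mem_Ico] at hi ⊢
    omega
  refine (Nat.cast_le.mpr h).trans ?_
  rw [Nat.cast_sub min_le_max, Nat.cast_max, Nat.cast_min, max_sub_min_eq_abs, abs_sub_comm]

lemma le_eucl_pt {d ε : ℝ} (h0 : 0 ≤ ε) (h1 : ε ≤ 1) (p q : Fin n × Fin 3) :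
    (1 - ε) * ((∑ i ∈ range (n - 1), if (p.1.val ≤ i ↔ q.1.val ≤ i) then 0 else 1 : ℕ) : ℝ)
      + ε * (if p.2 ≠ q.2 then d else 0) ≤ eucl (pt n d p) (pt n d q) := by
  refine convex_comb_le_sqrt h0 h1 ?_ ?_
  · simp only [pt, add_sub_add_right_eq_sub]
    rw [← sq_abs (_ - _ : ℝ)]
    exact pow_le_pow_left₀ (Nat.cast_nonneg _) (sum_crossing_indicator_le _ _ _) 2
  · split_ifs with h
    · have hz : (1 : ℝ) ≤ ((p.2.val : ℝ) - q.2.val) ^ 2 := by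
        have : ((p.2.val : ℤ) - q.2.val) ≠ 0 := by
          intro h'
          exact h (Fin.ext (by omega))
        have : (1 : ℤ) ≤ ((p.2.val : ℤ) - q.2.val) ^ 2 := by have := sq_pos_of_ne_zero this; omega
        exact_mod_cast this
      simp only [pt]
      nlinarith [mul_le_mul_of_nonneg_right hz (sq_nonneg d)]
    · simpa using sq_nonneg _

lemma IsTour.le_tourLength {t : ℕ → Fin n × Fin 3} (ht : IsTour n t) (hn : 1 ≤ n) {d : ℝ}
    (hd : 4 ≤ d) : (1 - 4 / d) * (4 * n - 6) ≤ tourLength n d t := by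
  have hd0 : 0 < d := by linarith
  have hε0 : 0 ≤ 4 / d := by positivity
  have hε1 : 4 / d ≤ 1 := (div_le_one hd0).mpr hd
  have hεd : 4 / d * d = 4 := by field_simp
  have hlen : (1 - 4 / d) * ((∑ i ∈ range (n - 1), crossings t i : ℕ) : ℝ)
      + 4 * #(rowChanges t) ≤ tourLength n d t := by
    have hs := sum_le_sum fun e (_ : e ∈ range (3 * n)) =>
      le_eucl_pt (n := n) (d := d) hε0 hε1 (t e) (t (e + 1))
    rw [sum_add_distrib, ← mul_sum, ← mul_sum, ← Nat.cast_sum, sum_comm, ← sum_filter, sum_const,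
      nsmul_eq_mul] at hs
    refine le_trans (le_of_eq ?_) hs
    rw [mul_left_comm, hεd, mul_comm (4 : ℝ)]
    rfl
  have hsum : 4 * ((n : ℝ) - 1) ≤
      ((∑ i ∈ range (n - 1), crossings t i : ℕ) : ℝ) + 4 * #(rowChanges t) + 2 := by
    have := ht.sum_crossings
    rw [← Nat.cast_one, ← Nat.cast_sub hn]
    exact_mod_cast this
  refine le_trans ?_ hlen
  nlinarith [mul_le_mul_of_nonneg_left hsum (sub_nonneg.mpr hε1),
    mul_nonneg hε0 (Nat.cast_nonneg (α := ℝ) #(rowChanges t))]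

end TourLower

/-! ### A short tour -/

section Snake

variable (m : ℕ)

/-- The tour that runs through the three rows one after the other in alternating directions. -/
def snake (i : ℕ) : Fin (m + 1) × Fin 3 :=
  (Fin.ofNat (m + 1)
    (if i < m + 1 then i else if i < 2 * (m + 1) then 2 * m + 1 - i else i - 2 * (m + 1)),
   if i < m + 1 then 0 else if i < 2 * (m + 1) then 1 else if i < 3 * (m + 1) then 2 else 0)

lemma snake_of_lt_one {i : ℕ} (h : i < m + 1) :
    snake m i = (⟨i, h⟩, 0) := by
  simp [snake, h, Fin.ext_iff, Nat.mod_eq_of_lt h]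

lemma snake_of_lt_two {i : ℕ} (h : m + 1 ≤ i) (h' : i < 2 * (m + 1)) :
    snake m i = (⟨2 * m + 1 - i, by omega⟩, 1) := by
  simp [snake, h', not_lt.mpr h, Fin.ext_iff]
  omega

lemma snake_of_lt_three {i : ℕ} (h : 2 * (m + 1) ≤ i) (h' : i < 3 * (m + 1)) :
    snake m i = (⟨i - 2 * (m + 1), by omega⟩, 2) := by
  have h1 : ¬ i < m + 1 := by omega
  simp [snake, h', not_lt.mpr h, h1, Fin.ext_iff]
  omega

lemma snake_end : snake m (3 * (m + 1)) = (⟨0, by omega⟩, 0) := by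
  have h1 : ¬ 3 * (m + 1) < m + 1 := by omega
  have h2 : ¬ 3 * (m + 1) < 2 * (m + 1) := by omega
  have h3 : 3 * (m + 1) - 2 * (m + 1) = m + 1 := by omega
  simp [snake, h1, h2, h3]

lemma isTour_snake : IsTour (m + 1) (snake m) := by
  refine ⟨(Fintype.bijective_iff_injective_and_card _).mpr ⟨?_, by simp [mul_comm]⟩, ?_⟩
  · rintro ⟨i, hi⟩ ⟨j, hj⟩ h
    simp only [Fin.mk.injEq] at h ⊢
    rcases lt_or_ge i (m + 1) with hi1 | hi1
    · rw [snake_of_lt_one m hi1] at h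
      rcases lt_or_ge j (m + 1) with hj1 | hj1
      · rw [snake_of_lt_one m hj1] at h
        simpa using h
      rcases lt_or_ge j (2 * (m + 1)) with hj2 | hj2
      · simp [snake_of_lt_two m hj1 hj2] at h
      · simp [snake_of_lt_three m hj2 hj] at h
    rcases lt_or_ge i (2 * (m + 1)) with hi2 | hi2
    · rw [snake_of_lt_two m hi1 hi2] at h
      rcases lt_or_ge j (m + 1) with hj1 | hj1
      · simp [snake_of_lt_one m hj1] at h
      rcases lt_or_ge j (2 * (m + 1)) with hj2 | hj2
      · simp [snake_of_lt_two m hj1 hj2] at h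
        omega
      · simp [snake_of_lt_three m hj2 hj] at h
    · rw [snake_of_lt_three m hi2 hi] at h
      rcases lt_or_ge j (m + 1) with hj1 | hj1
      · simp [snake_of_lt_one m hj1] at h
      rcases lt_or_ge j (2 * (m + 1)) with hj2 | hj2
      · simp [snake_of_lt_two m hj1 hj2] at h
      · simp [snake_of_lt_three m hj2 hj] at h
        omega
  · rw [snake_end, snake_of_lt_one m (Nat.succ_pos m)]

lemma eucl_le_abs_add_abs (p q : ℝ × ℝ) : eucl p q ≤ |p.1 - q.1| + |p.2 - q.2| := by
  refine Real.sqrt_le_iff.mpr ⟨by positivity, ?_⟩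
  nlinarith [sq_abs (p.1 - q.1), sq_abs (p.2 - q.2),
    mul_nonneg (abs_nonneg (p.1 - q.1)) (abs_nonneg (p.2 - q.2))]

lemma tourLength_snake_le {d : ℝ} (hd : 0 ≤ d) :
    tourLength (m + 1) d (snake m) ≤ 4 * ((m + 1 : ℕ) : ℝ) + 4 * d := by
  have hstep : ∀ i ∈ range (3 * (m + 1)),
      eucl (pt (m + 1) d (snake m i)) (pt (m + 1) d (snake m (i + 1))) ≤
        1 + (if i = m then d else 0) + (if i = 2 * m + 1 then d else 0)
          + (if i = 3 * m + 2 then ((m + 1 : ℕ) : ℝ) + 2 * d else 0) := by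
    intro i hi
    have hi3 := mem_range.mp hi
    refine (eucl_le_abs_add_abs _ _).trans ?_
    rcases lt_or_ge i m with h | h
    · rw [snake_of_lt_one m (by omega), snake_of_lt_one m (by omega)]
      simp only [pt]
      rw [if_neg (by omega), if_neg (by omega), if_neg (by omega)]
      simp
    rcases h.eq_or_lt with rfl | h
    · rw [snake_of_lt_one m (by omega), snake_of_lt_two m (by omega) (by omega)]
      simp only [pt]
      rw [if_pos trivial, if_neg (by omega), if_neg (by omega), show 2 * m + 1 - (m + 1) = m by omega]
      simp [add_mul, abs_of_nonneg hd]
    rcases lt_or_ge i (2 * m + 1) with h' | h'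
    · rw [snake_of_lt_two m (by omega) (by omega), snake_of_lt_two m (by omega) (by omega)]
      simp only [pt]
      rw [if_neg (by omega), if_neg (by omega), if_neg (by omega),
        show 2 * m + 1 - i = (2 * m + 1 - (i + 1)) + 1 by omega]
      simp
    rcases h'.eq_or_lt with rfl | h'
    · rw [snake_of_lt_two m (by omega) (by omega), snake_of_lt_three m (by omega) (by omega)]
      simp only [pt]
      rw [if_neg (by omega), if_pos trivial, if_neg (by omega), show 2 * m + 1 - (2 * m + 1) = 0 by omega,
        show 2 * m + 1 + 1 - 2 * (m + 1) = 0 by omega]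
      simp [← sub_mul, abs_mul, abs_of_nonneg hd]
      norm_num
    rcases lt_or_ge i (3 * m + 2) with h3 | h3
    · rw [snake_of_lt_three m (by omega) (by omega), snake_of_lt_three m (by omega) (by omega)]
      simp only [pt]
      rw [if_neg (by omega), if_neg (by omega), if_neg (by omega),
        show i + 1 - 2 * (m + 1) = (i - 2 * (m + 1)) + 1 by omega]
      simp
    · obtain rfl : i = 3 * m + 2 := by omega
      rw [snake_of_lt_three m (by omega) (by omega), show 3 * m + 2 + 1 = 3 * (m + 1) by ring,
        snake_end]
      simp only [pt]
      rw [if_neg (by omega), if_neg (by omega), if_pos trivial,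
        show 3 * m + 2 - 2 * (m + 1) = m by omega]
      have h2 : |(2 + 1) * d - d| = 2 * d := by
        rw [show (2 + 1) * d - d = 2 * d by ring, abs_of_nonneg (by positivity)]
      simp [h2]
      linarith
  refine (sum_le_sum hstep).trans ?_
  have h1 : m < 3 * (m + 1) := by omega
  have h2 : 2 * m + 1 < 3 * (m + 1) := by omega
  have h3 : 3 * m + 2 < 3 * (m + 1) := by omega
  simp only [sum_add_distrib, sum_ite_eq', mem_range, h1, h2, h3, if_true, sum_const, card_range,
    nsmul_eq_mul]
  push_cast
  linarith

end Snake

/-! ### The subtour LP -/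

section LPLower

variable {n : ℕ} {d : ℝ}

lemma one_le_eucl_pt (hd : 1 ≤ d) {p q : Fin n × Fin 3} (hpq : p ≠ q) :
    1 ≤ eucl (pt n d p) (pt n d q) := by
  have hcast : ∀ a b : ℕ, a ≠ b → (1 : ℝ) ≤ ((a : ℝ) - b) ^ 2 := by
    intro a b hab
    have h0 : ((a : ℤ) - b) ≠ 0 := by omega
    have h1 : (1 : ℤ) ≤ ((a : ℤ) - b) ^ 2 := by
      have := sq_pos_of_ne_zero h0
      omega
    exact_mod_cast h1
  apply Real.le_sqrt_of_sq_le
  simp only [pt, add_sub_add_right_eq_sub, ← sub_mul, mul_pow]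
  by_cases h : p.1 = q.1
  · have h2 : p.2.val ≠ q.2.val := fun h' => hpq (Prod.ext h (Fin.ext h'))
    nlinarith [hcast _ _ h2, sq_nonneg ((p.1.val : ℝ) - q.1.val)]
  · have h1 : p.1.val ≠ q.1.val := fun h' => h (Fin.ext h')
    nlinarith [hcast _ _ h1, mul_nonneg (sq_nonneg ((p.2.val : ℝ) - q.2.val)) (sq_nonneg d)]

lemma SubtourLPFeasible.le_lpValue {x : Fin n × Fin 3 → Fin n × Fin 3 → ℝ}
    (hx : SubtourLPFeasible n x) (hd : 1 ≤ d) : 3 * (n : ℝ) ≤ lpValue n d x := by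
  obtain ⟨_, hdiag, hbd, hdeg, _⟩ := hx
  have h : ∑ i : Fin n × Fin 3, ∑ j, x i j ≤ ∑ i, ∑ j, eucl (pt n d i) (pt n d j) * x i j := by
    refine sum_le_sum fun i _ => sum_le_sum fun j _ => ?_
    by_cases hij : i = j
    · rw [hij, hdiag, mul_zero]
    · exact le_mul_of_one_le_left (hbd i j).1 (one_le_eucl_pt hd hij)
  simp only [hdeg, sum_const, card_univ, Fintype.card_prod, Fintype.card_fin, nsmul_eq_mul] at h
  push_cast at h
  unfold lpValue
  linarith

end LPLower

section LPUpper

/-- The symmetric incidence function of the edge `{a, b}`. -/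
def edgeInd {V : Type*} [DecidableEq V] (a b p q : V) : ℝ :=
  (if p = a then 1 else 0) * (if q = b then 1 else 0) +
    (if p = b then 1 else 0) * (if q = a then 1 else 0)

section EdgeInd

variable {V : Type*} [DecidableEq V] (a b p q : V)

lemma edgeInd_comm : edgeInd a b p q = edgeInd a b q p := by
  unfold edgeInd
  ring

lemma edgeInd_nonneg : 0 ≤ edgeInd a b p q := by
  unfold edgeInd
  positivity

variable {a b} in
lemma edgeInd_self (h : a ≠ b) : edgeInd a b p p = 0 := by
  unfold edgeInd
  split_ifs <;> simp_all

variable [Fintype V]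

lemma sum_edgeInd :
    ∑ q, edgeInd a b p q = (if p = a then 1 else 0) + (if p = b then 1 else 0) := by
  simp [edgeInd, sum_add_distrib]

lemma sum_sum_mul_edgeInd (w : V → V → ℝ) :
    ∑ p, ∑ q, w p q * edgeInd a b p q = w a b + w b a := by
  simp [edgeInd, mul_add, sum_add_distrib]

end EdgeInd

variable (m : ℕ)

/-- The fractional subtour solution made of the three rows and two triangles of half-edges
joining the ends of the rows. -/
def rowSolution (p q : Fin (m + 1) × Fin 3) : ℝ :=
  ∑ j : Fin 3, (∑ i : Fin m, edgeInd (i.castSucc, j) (i.succ, j) p q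
    + (1 / 2) * edgeInd (0, j) (0, j + 1) p q
    + (1 / 2) * edgeInd (Fin.last m, j) (Fin.last m, j + 1) p q)

lemma sum_sum_mul_rowSolution (w : Fin (m + 1) × Fin 3 → Fin (m + 1) × Fin 3 → ℝ) :
    ∑ p, ∑ q, w p q * rowSolution m p q =
      ∑ j : Fin 3, (∑ i : Fin m, (w (i.castSucc, j) (i.succ, j) + w (i.succ, j) (i.castSucc, j))
        + (1 / 2) * (w (0, j) (0, j + 1) + w (0, j + 1) (0, j))
        + (1 / 2) * (w (Fin.last m, j) (Fin.last m, j + 1)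
          + w (Fin.last m, j + 1) (Fin.last m, j))) := by
  have hs : ∀ {ι : Type} [Fintype ι] (f : ι → Fin (m + 1) × Fin 3 → Fin (m + 1) × Fin 3 → ℝ),
      ∑ p, ∑ q, w p q * ∑ j, f j p q = ∑ j, ∑ p, ∑ q, w p q * f j p q := fun f => by
    simp only [mul_sum]
    rw [sum_congr rfl fun p _ => sum_comm, sum_comm]
  unfold rowSolution
  rw [hs]
  refine sum_congr rfl fun j _ => ?_
  simp only [mul_add, sum_add_distrib, hs, mul_left_comm _ (1 / 2 : ℝ), ← mul_sum,
    sum_sum_mul_edgeInd]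

lemma sum_rowSolution (p : Fin (m + 1) × Fin 3) : ∑ q, rowSolution m p q = 2 := by
  have hrow : ∀ j : Fin 3, ∑ q, (∑ i : Fin m, edgeInd (i.castSucc, j) (i.succ, j) p q
      + (1 / 2) * edgeInd (0, j) (0, j + 1) p q
      + (1 / 2) * edgeInd (Fin.last m, j) (Fin.last m, j + 1) p q) =
      2 * (if p.2 = j then 1 else 0)
      + (1 / 2) * ((if p = (0, j + 1) then 1 else 0) - (if p = (0, j) then 1 else 0))
      + (1 / 2) * ((if p = (Fin.last m, j + 1) then 1 else 0)
        - (if p = (Fin.last m, j) then 1 else 0)) := by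
    intro j
    have hk : ∑ k : Fin (m + 1), (if p = (k, j) then (1 : ℝ) else 0) = if p.2 = j then 1 else 0 := by
      obtain ⟨k, l⟩ := p
      by_cases h : l = j <;> simp [h]
    have h1 := hk
    have h2 := hk
    rw [Fin.sum_univ_succ] at h1
    rw [Fin.sum_univ_castSucc] at h2
    rw [sum_add_distrib, sum_add_distrib, sum_comm, ← mul_sum, ← mul_sum]
    simp only [sum_edgeInd, sum_add_distrib]
    linarith
  unfold rowSolution
  rw [sum_comm, sum_congr rfl fun j _ => hrow j]
  simp only [Fin.sum_univ_three, show (2 : Fin 3) + 1 = 0 from rfl, show (1 : Fin 3) + 1 = 2 from rfl,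
    show (0 : Fin 3) + 1 = 1 from rfl]
  have h : (∑ j : Fin 3, if p.2 = j then (1 : ℝ) else 0) = 1 := by simp
  rw [Fin.sum_univ_three] at h
  linarith

lemma abs_sub_le_sum_steps (f : Fin (m + 1) → ℝ) (k : Fin (m + 1)) :
    |f 0 - f k| + |f k - f (Fin.last m)| ≤ ∑ i : Fin m, |f i.castSucc - f i.succ| := by
  induction m with
  | zero => simp [Fin.fin_one_eq_zero k]
  | succ m ih =>
    rw [Fin.sum_univ_succ]
    simp only [Fin.castSucc_zero, Fin.succ_zero_eq_one, ← Fin.succ_castSucc]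
    cases k using Fin.cases with
    | zero =>
      have h := ih (fun i => f i.succ) 0
      have h' := abs_sub_le (f 0) (f 1) (f (Fin.last (m + 1)))
      simp only [Fin.succ_zero_eq_one, Fin.succ_last, sub_self, abs_zero] at h ⊢
      linarith
    | succ k =>
      have h := ih (fun i => f i.succ) k
      have h' := abs_sub_le (f 0) (f 1) (f k.succ)
      simp only [Fin.succ_zero_eq_one, Fin.succ_last] at h ⊢
      linarith

/-- Every nonempty proper vertex set has a cut of weight at least two in `rowSolution`. -/
lemma two_le_cut_rowSolution {S : Finset (Fin (m + 1) × Fin 3)} (hS : S.Nonempty)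
    (hS' : S ≠ univ) :
    4 ≤ ∑ p, ∑ q, |(if p ∈ S then (1 : ℝ) else 0) - (if q ∈ S then 1 else 0)|
      * rowSolution m p q := by
  obtain ⟨a, ha⟩ := hS
  obtain ⟨b, hb⟩ : ∃ b, b ∉ S := by
    by_contra! h
    exact hS' (eq_univ_of_forall h)
  rw [sum_sum_mul_rowSolution]
  set u : Fin (m + 1) × Fin 3 → ℝ := fun p => if p ∈ S then 1 else 0 with hu
  have hu01 : ∀ p, u p = 0 ∨ u p = 1 := fun p => by simp only [hu]; split_ifs <;> simp
  have hua : u a = 1 := if_pos ha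
  have hub : u b = 0 := if_neg hb
  set L : Fin 3 → ℝ := fun j => u (0, j) with hL
  set R : Fin 3 → ℝ := fun j => u (Fin.last m, j) with hR
  have hbound : ∀ k : Fin (m + 1),
      ∑ j, (2 * (|L j - u (k, j)| + |u (k, j) - R j|) + |L j - L (j + 1)| + |R j - R (j + 1)|) ≤
      ∑ j : Fin 3, (∑ i : Fin m, (|u (i.castSucc, j) - u (i.succ, j)|
          + |u (i.succ, j) - u (i.castSucc, j)|)
        + (1 / 2) * (|u (0, j) - u (0, j + 1)| + |u (0, j + 1) - u (0, j)|)
        + (1 / 2) * (|u (Fin.last m, j) - u (Fin.last m, j + 1)|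
          + |u (Fin.last m, j + 1) - u (Fin.last m, j)|)) := by
    refine fun k => sum_le_sum fun j _ => ?_
    have h := abs_sub_le_sum_steps m (fun i => u (i, j)) k
    simp only [abs_sub_comm (u (Fin.succ _, j)), abs_sub_comm (u (_, j + 1)), ← two_mul, ← mul_sum]
    linarith
  have hrow : ∀ (k : Fin (m + 1)) (l : Fin 3), 2 * (|L l - u (k, l)| + |u (k, l) - R l|) ≤
      ∑ j, (2 * (|L j - u (k, j)| + |u (k, j) - R j|) + |L j - L (j + 1)|
        + |R j - R (j + 1)|) := by
    intro k l
    refine le_trans ?_ (single_le_sum (fun j _ => by positivity) (mem_univ l))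
    linarith [abs_nonneg (L l - L (l + 1)), abs_nonneg (R l - R (l + 1))]
  by_cases hc : ∀ j, L j = R j ∧ L j = L 0
  · rcases hu01 (0, 0) with h0 | h0
    · refine le_trans ?_ ((hrow a.1 a.2).trans (hbound a.1))
      rw [← (hc a.2).1, (hc a.2).2, hua, hL]
      norm_num [h0]
    · refine le_trans ?_ ((hrow b.1 b.2).trans (hbound b.1))
      rw [← (hc b.2).1, (hc b.2).2, hub, hL]
      norm_num [h0]
  · refine le_trans ?_ (hbound 0)
    have hL01 : ∀ j, L j = 0 ∨ L j = 1 := fun j => hu01 _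
    have hR01 : ∀ j, R j = 0 ∨ R j = 1 := fun j => hu01 _
    change 4 ≤ ∑ j, (2 * (|L j - L j| + |L j - R j|) + |L j - L (j + 1)| + |R j - R (j + 1)|)
    clear_value L R
    simp only [Fin.sum_univ_three, Fin.forall_fin_succ, show (2 : Fin 3) + 1 = 0 from rfl,
      show (1 : Fin 3) + 1 = 2 from rfl, show (0 : Fin 3) + 1 = 1 from rfl] at hc ⊢
    rcases hL01 0 with h0 | h0 <;> rcases hL01 1 with h1 | h1 <;> rcases hL01 2 with h2 | h2 <;>
    rcases hR01 0 with h3 | h3 <;> rcases hR01 1 with h4 | h4 <;> rcases hR01 2 with h5 | h5 <;>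
    first
    | norm_num [h0, h1, h2, h3, h4, h5]; done
    | norm_num [h0, h1, h2, h3, h4, h5] at hc

lemma rowSolution_feasible : SubtourLPFeasible (m + 1) (rowSolution m) := by
  have hsymm : ∀ p q, rowSolution m p q = rowSolution m q p := by
    intro p q
    simp only [rowSolution, edgeInd_comm _ _ p q]
  have hnonneg : ∀ p q, 0 ≤ rowSolution m p q := fun p q =>
    sum_nonneg fun j _ => add_nonneg (add_nonneg (sum_nonneg fun i _ => edgeInd_nonneg _ _ _ _)
      (mul_nonneg (by norm_num) (edgeInd_nonneg _ _ _ _)))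
      (mul_nonneg (by norm_num) (edgeInd_nonneg _ _ _ _))
  have hdiag : ∀ p, rowSolution m p p = 0 := by
    intro p
    refine sum_eq_zero fun j _ => ?_
    have hj : j ≠ j + 1 := by revert j; decide
    rw [edgeInd_self p (by simp [hj]), edgeInd_self p (by simp [hj]),
      sum_eq_zero fun i _ => edgeInd_self p (by simp [Fin.ext_iff])]
    simp
  have hsub : ∀ S : Finset (Fin (m + 1) × Fin 3), S.Nonempty → S ≠ univ →
      ∑ p ∈ S, ∑ q ∈ S, rowSolution m p q ≤ 2 * ((#S : ℝ) - 1) := by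
    intro S hS hS'
    have hcut := two_le_cut_rowSolution m hS hS'
    have hdeg : ∑ p, ∑ q, (if p ∈ S then (1 : ℝ) else 0) * rowSolution m p q = 2 * #S := by
      simp [sum_rowSolution, mul_comm]
    have hdeg' : ∑ p, ∑ q, (if q ∈ S then (1 : ℝ) else 0) * rowSolution m p q = 2 * #S := by
      rw [sum_comm, ← hdeg]
      simp only [hsymm]
    have hin : ∑ p, ∑ q, (if p ∈ S then (1 : ℝ) else 0) * (if q ∈ S then 1 else 0)
        * rowSolution m p q = ∑ p ∈ S, ∑ q ∈ S, rowSolution m p q := by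
      simp [sum_ite_mem]
    have habs : ∑ p, ∑ q, |(if p ∈ S then (1 : ℝ) else 0) - (if q ∈ S then 1 else 0)|
        * rowSolution m p q =
        ∑ p, ∑ q, (if p ∈ S then (1 : ℝ) else 0) * rowSolution m p q
        + ∑ p, ∑ q, (if q ∈ S then (1 : ℝ) else 0) * rowSolution m p q
        - 2 * ∑ p, ∑ q, (if p ∈ S then (1 : ℝ) else 0) * (if q ∈ S then 1 else 0)
          * rowSolution m p q := by
      simp only [mul_sum, ← sum_add_distrib, ← sum_sub_distrib]
      refine sum_congr rfl fun p _ => sum_congr rfl fun q _ => ?_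
      split_ifs <;> norm_num
      ring
    rw [habs, hdeg, hdeg', hin] at hcut
    linarith
  refine ⟨hsymm, hdiag, fun p q => ⟨hnonneg p q, ?_⟩, sum_rowSolution m, hsub⟩
  by_cases hpq : p = q
  · rw [hpq, hdiag]
    exact zero_le_one
  · have h := hsub {p, q} (by simp) fun h => by
      have := congrArg card h
      rw [card_pair hpq] at this
      simp at this
      omega
    rw [sum_pair hpq, sum_pair hpq, sum_pair hpq, card_pair hpq, hdiag, hdiag, hsymm q p] at h
    norm_num at h
    linarith

lemma eucl_comm (p q : ℝ × ℝ) : eucl p q = eucl q p := by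
  unfold eucl
  congr 1
  ring

lemma lpValue_rowSolution_le {d : ℝ} (hd : 0 ≤ d) :
    lpValue (m + 1) d (rowSolution m) ≤ 3 * ((m + 1 : ℕ) : ℝ) + 4 * d := by
  have hpath : ∀ (i : Fin m) (j : Fin 3),
      eucl (pt (m + 1) d (i.castSucc, j)) (pt (m + 1) d (i.succ, j)) ≤ 1 := by
    intro i j
    refine (eucl_le_abs_add_abs _ _).trans ?_
    simp [pt]
  have htri : ∀ (k : Fin (m + 1)) (j l : Fin 3),
      eucl (pt (m + 1) d (k, j)) (pt (m + 1) d (k, l)) ≤ |(j.val : ℝ) - l.val| * d := by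
    intro k j l
    refine (eucl_le_abs_add_abs _ _).trans ?_
    simp [pt, ← sub_mul, abs_mul, abs_of_nonneg hd]
  unfold lpValue
  rw [sum_sum_mul_rowSolution]
  have hrow : ∀ j : Fin 3, ∑ i : Fin m,
      (eucl (pt (m + 1) d (i.castSucc, j)) (pt (m + 1) d (i.succ, j))
        + eucl (pt (m + 1) d (i.succ, j)) (pt (m + 1) d (i.castSucc, j))) ≤ m * 2 := by
    intro j
    refine (sum_le_card_nsmul _ _ 2 fun i _ => ?_).trans_eq (by simp)
    rw [eucl_comm (pt (m + 1) d (i.succ, j))]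
    linarith [hpath i j]
  have hcorner : ∀ k : Fin (m + 1), ∑ j : Fin 3,
      (eucl (pt (m + 1) d (k, j)) (pt (m + 1) d (k, j + 1))
        + eucl (pt (m + 1) d (k, j + 1)) (pt (m + 1) d (k, j))) ≤ 8 * d := by
    intro k
    refine (sum_le_sum fun j _ => add_le_add (htri k j (j + 1)) (htri k (j + 1) j)).trans_eq ?_
    simp only [Fin.sum_univ_three, show (2 : Fin 3) + 1 = 0 from rfl,
      show (1 : Fin 3) + 1 = 2 from rfl, show (0 : Fin 3) + 1 = 1 from rfl]
    norm_num
    ring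
  have hrows := sum_le_sum fun j (_ : j ∈ univ) => hrow j
  have h0 := hcorner 0
  have hlast := hcorner (Fin.last m)
  simp only [sum_const, card_univ, Fintype.card_fin, nsmul_eq_mul] at hrows
  rw [sum_add_distrib, sum_add_distrib, ← mul_sum, ← mul_sum]
  push_cast at hrows ⊢
  linarith

end LPUpper

/-! ### The integrality ratio -/

lemma optTour_bounds {n : ℕ} (hn : 1 ≤ n) {d : ℝ} (hd : 4 ≤ d) :
    (1 - 4 / d) * (4 * n - 6) ≤ optTour n d ∧ optTour n d ≤ 4 * n + 4 * d := by
  obtain ⟨m, rfl⟩ := Nat.exists_eq_add_of_le' hn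
  have hlow : (1 - 4 / d) * (4 * ((m + 1 : ℕ) : ℝ) - 6) ∈
      lowerBounds {L | ∃ t, IsTour (m + 1) t ∧ tourLength (m + 1) d t = L} := by
    rintro _ ⟨t, ht, rfl⟩
    exact ht.le_tourLength hn hd
  exact ⟨le_csInf ⟨_, snake m, isTour_snake m, rfl⟩ hlow,
    (csInf_le ⟨_, hlow⟩ ⟨snake m, isTour_snake m, rfl⟩).trans
      (tourLength_snake_le m (by linarith))⟩

lemma optLP_bounds {n : ℕ} (hn : 1 ≤ n) {d : ℝ} (hd : 1 ≤ d) :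
    3 * (n : ℝ) ≤ optLP n d ∧ optLP n d ≤ 3 * n + 4 * d := by
  obtain ⟨m, rfl⟩ := Nat.exists_eq_add_of_le' hn
  have hlow : 3 * ((m + 1 : ℕ) : ℝ) ∈
      lowerBounds {L | ∃ x, SubtourLPFeasible (m + 1) x ∧ lpValue (m + 1) d x = L} := by
    rintro _ ⟨x, hx, rfl⟩
    exact hx.le_lpValue hd
  exact ⟨le_csInf ⟨_, rowSolution m, rowSolution_feasible m, rfl⟩ hlow,
    (csInf_le ⟨_, hlow⟩ ⟨rowSolution m, rowSolution_feasible m, rfl⟩).trans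
      (lpValue_rowSolution_le m (by linarith))⟩

/-- If `d(n) → ∞` and `d(n)/n → 0`, then the integrality ratio of the subtour
LP for the instances `G(n, d(n))` converges to `4/3`. -/
theorem statement0 (d : ℕ → ℝ)
    (hd : Tendsto d atTop atTop)
    (hdn : Tendsto (fun n : ℕ => d n / (n : ℝ)) atTop (nhds 0)) :
    Tendsto (fun n : ℕ => optTour n (d n) / optLP n (d n)) atTop (nhds (4 / 3)) := by
  have hev : ∀ᶠ n : ℕ in atTop, 1 ≤ n ∧ 4 ≤ d n :=
    (eventually_ge_atTop 1).and (hd.eventually_ge_atTop 4)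
  have hinv : Tendsto (fun n : ℕ => (6 : ℝ) / n) atTop (nhds 0) :=
    tendsto_const_div_atTop_nhds_zero_nat 6
  have hdinv : Tendsto (fun n : ℕ => 4 / d n) atTop (nhds 0) := hd.const_div_atTop 4
  have htour : Tendsto (fun n : ℕ => optTour n (d n) / n) atTop (nhds 4) := by
    have hl : Tendsto (fun n : ℕ => (1 - 4 / d n) * (4 - 6 / (n : ℝ))) atTop (nhds 4) := by
      simpa using (hdinv.const_sub 1).mul (hinv.const_sub 4)
    have hu : Tendsto (fun n : ℕ => 4 + 4 * (d n / (n : ℝ))) atTop (nhds 4) := by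
      simpa using (hdn.const_mul 4).const_add 4
    refine tendsto_of_tendsto_of_tendsto_of_le_of_le' hl hu ?_ ?_
    · filter_upwards [hev] with n ⟨hn, hdn4⟩
      have hn0 : (0 : ℝ) < n := by exact_mod_cast hn
      rw [le_div_iff₀ hn0]
      refine le_of_eq_of_le ?_ (optTour_bounds hn hdn4).1
      field_simp
    · filter_upwards [hev] with n ⟨hn, hdn4⟩
      have hn0 : (0 : ℝ) < n := by exact_mod_cast hn
      rw [div_le_iff₀ hn0]
      refine (optTour_bounds hn hdn4).2.trans_eq ?_
      field_simp
  have hlp : Tendsto (fun n : ℕ => optLP n (d n) / n) atTop (nhds 3) := by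
    have hu : Tendsto (fun n : ℕ => 3 + 4 * (d n / (n : ℝ))) atTop (nhds 3) := by
      simpa using (hdn.const_mul 4).const_add 3
    refine tendsto_of_tendsto_of_tendsto_of_le_of_le' tendsto_const_nhds hu ?_ ?_
    · filter_upwards [hev] with n ⟨hn, hdn4⟩
      have hn0 : (0 : ℝ) < n := by exact_mod_cast hn
      rw [le_div_iff₀ hn0]
      exact (optLP_bounds hn (by linarith)).1
    · filter_upwards [hev] with n ⟨hn, hdn4⟩
      have hn0 : (0 : ℝ) < n := by exact_mod_cast hn
      rw [div_le_iff₀ hn0]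
      refine (optLP_bounds hn (by linarith)).2.trans_eq ?_
      field_simp
  refine (htour.div hlp (by norm_num)).congr' ?_
  filter_upwards [eventually_ge_atTop 1] with n hn
  have hn0 : (n : ℝ) ≠ 0 := by positivity
  exact div_div_div_cancel_right₀ hn0 _ _

end
end

section
/- Let n ≥ 3 be a natural number and let d > 0 be a real number. Then the optimum value of the subtour LP for the instance G(n,d) is at most 3n − 4 + 3d + √(d² + 1); in particular there exists a feasible solution of the subtour LP for G(n,d) whose objective value equals 3n − 4 + 3d + √(d² + 1). -/
open Real Filter Finset

noncomputable section

section Prism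

variable {V : Type*}

/-- The symmetric weight of the single edge `ab`. -/
def edgeWeight [DecidableEq V] (a b i j : V) : ℝ :=
  (if i = a then 1 else 0) * (if j = b then 1 else 0) +
    (if i = b then 1 else 0) * (if j = a then 1 else 0)

/-- Three paths `p c 0, …, p c (L c)` with edges of weight `1`, whose starting points, and whose
end points, are joined by a triangle with edges of weight `1/2`. -/
def prismWeight [DecidableEq V] (L : Fin 3 → ℕ) (p : Fin 3 → ℕ → V) : V → V → ℝ :=
  ∑ c, (∑ t ∈ range (L c), edgeWeight (p c t) (p c (t + 1)) +
    (1 / 2 : ℝ) • (edgeWeight (p c 0) (p (c + 1) 0) +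
      edgeWeight (p c (L c)) (p (c + 1) (L (c + 1)))))

/-- The total of `f` over the edges of the prism, taken with their weights. -/
def prismSum (L : Fin 3 → ℕ) (p : Fin 3 → ℕ → V) (f : V → V → ℝ) : ℝ :=
  ∑ c, (∑ t ∈ range (L c), f (p c t) (p c (t + 1)) +
    (1 / 2) * (f (p c 0) (p (c + 1) 0) + f (p c (L c)) (p (c + 1) (L (c + 1)))))

/-- The linear functional pairing edge weights with `f`. -/
def pairing [Fintype V] (f : V → V → ℝ) : (V → V → ℝ) →ₗ[ℝ] ℝ where
  toFun x := ∑ i, ∑ j, f i j * x i j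
  map_add' x y := by simp [mul_add, sum_add_distrib]
  map_smul' r x := by simp [mul_sum, mul_left_comm]

theorem pairing_apply [Fintype V] (f x : V → V → ℝ) : pairing f x = ∑ i, ∑ j, f i j * x i j := rfl

theorem pairing_edgeWeight [Fintype V] [DecidableEq V] (f : V → V → ℝ) (a b : V) :
    pairing f (edgeWeight a b) = f a b + f b a := by
  simp [pairing_apply, edgeWeight, mul_add, sum_add_distrib]

theorem pairing_prismWeight [Fintype V] [DecidableEq V] (L : Fin 3 → ℕ)
    (p : Fin 3 → ℕ → V) (f : V → V → ℝ) :
    pairing f (prismWeight L p) = prismSum L p (fun a b => f a b + f b a) := by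
  simp only [prismWeight, prismSum, map_sum, map_add, map_smul, pairing_edgeWeight, smul_eq_mul]

theorem edgeWeight_comm [DecidableEq V] (a b i j : V) :
    edgeWeight a b i j = edgeWeight a b j i := by
  unfold edgeWeight; ring

theorem edgeWeight_nonneg [DecidableEq V] (a b i j : V) : 0 ≤ edgeWeight a b i j := by
  unfold edgeWeight; positivity

theorem prismWeight_apply [DecidableEq V] (L : Fin 3 → ℕ) (p : Fin 3 → ℕ → V) (i j : V) :
    prismWeight L p i j = prismSum L p (fun a b => edgeWeight a b i j) := by
  simp [prismWeight, prismSum, mul_add]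

theorem prismWeight_comm [DecidableEq V] (L : Fin 3 → ℕ) (p : Fin 3 → ℕ → V) (i j : V) :
    prismWeight L p i j = prismWeight L p j i := by
  simp only [prismWeight_apply, edgeWeight_comm _ _ i j]

theorem prismSum_nonneg (L : Fin 3 → ℕ) (p : Fin 3 → ℕ → V) {f : V → V → ℝ}
    (hf : ∀ a b, 0 ≤ f a b) : 0 ≤ prismSum L p f := by
  unfold prismSum
  refine sum_nonneg fun c _ => add_nonneg (sum_nonneg fun t _ => hf _ _) ?_
  have := hf (p c 0) (p (c + 1) 0)
  have := hf (p c (L c)) (p (c + 1) (L (c + 1)))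
  positivity

theorem prismWeight_nonneg [DecidableEq V] (L : Fin 3 → ℕ) (p : Fin 3 → ℕ → V) (i j : V) :
    0 ≤ prismWeight L p i j := by
  rw [prismWeight_apply]
  exact prismSum_nonneg L p fun a b => edgeWeight_nonneg a b i j

theorem sum_range_add_succ (u : ℕ → ℝ) (k : ℕ) :
    ∑ t ∈ range k, (u t + u (t + 1)) = 2 * ∑ t ∈ range (k + 1), u t - u 0 - u k := by
  rw [sum_add_distrib]
  have h1 := sum_range_succ u k
  have h2 := sum_range_succ' u k
  linarith

theorem prismSum_endpoints [Fintype V] {L : Fin 3 → ℕ} {p : Fin 3 → ℕ → V}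
    (hp : ∀ g : V → ℝ, ∑ v, g v = ∑ c, ∑ t ∈ range (L c + 1), g (p c t)) (g : V → ℝ) :
    prismSum L p (fun a b => g a + g b) = 2 * ∑ v, g v := by
  rw [hp g]
  have h (c : Fin 3) := sum_range_add_succ (fun t => g (p c t)) (L c)
  simp only [prismSum, h, Fin.sum_univ_three]
  have h2 : (2 : Fin 3) + 1 = 0 := rfl
  have h1 : (1 : Fin 3) + 1 = 2 := rfl
  simp only [h2, h1, zero_add]
  ring

theorem sum_prismWeight [Fintype V] [DecidableEq V] {L : Fin 3 → ℕ} {p : Fin 3 → ℕ → V}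
    (hp : ∀ g : V → ℝ, ∑ v, g v = ∑ c, ∑ t ∈ range (L c + 1), g (p c t)) (v : V) :
    ∑ j, prismWeight L p v j = 2 := by
  have h := pairing_prismWeight L p (fun i _ => if i = v then 1 else 0)
  rw [prismSum_endpoints hp (fun i => if i = v then 1 else 0), pairing_apply] at h
  simpa [← mul_sum] using h

/-- A `0/1` sequence is constant, or changes once and has distinct ends, or changes twice. -/
theorem sum_sq_sub_trichotomy (u : ℕ → ℝ) (hu : ∀ t, u t = 0 ∨ u t = 1) (k : ℕ) :
    (∀ t ≤ k, u t = u 0) ∨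
      (1 ≤ ∑ t ∈ range k, (u t - u (t + 1)) ^ 2 ∧ u 0 ≠ u k) ∨
      2 ≤ ∑ t ∈ range k, (u t - u (t + 1)) ^ 2 := by
  have hjump {i j : ℕ} (h : u i ≠ u j) : (u i - u j) ^ 2 = 1 := by
    rcases hu i with a | a <;> rcases hu j with b | b <;> simp_all
  induction k with
  | zero => left; intro t ht; rw [Nat.le_zero.mp ht]
  | succ k ih =>
    rw [sum_range_succ]
    rcases ih with h | ⟨h, h'⟩ | h
    · by_cases hk : u (k + 1) = u 0
      · left
        intro t ht
        rcases Nat.le_succ_iff.mp ht with ht | rfl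
        exacts [h t ht, hk]
      · right; left
        have h0 : 0 ≤ ∑ t ∈ range k, (u t - u (t + 1)) ^ 2 := sum_nonneg fun t _ => sq_nonneg _
        refine ⟨?_, fun h => hk h.symm⟩
        rw [h k le_rfl, hjump (Ne.symm hk)]
        linarith
    · by_cases hk : u 0 = u (k + 1)
      · right; right
        rw [← hk, hjump h'.symm]
        linarith
      · right; left
        exact ⟨by nlinarith [sq_nonneg (u k - u (k + 1))], hk⟩
    · right; right
      nlinarith [sq_nonneg (u k - u (k + 1))]

/-- A prism cut has weight at least `2`: `a c` and `b c` say on which side of the cut the ends of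
path `c` lie, and `D c` is the number of edges of that path in the cut. -/
theorem two_le_add_triangle_cut {a b D : Fin 3 → ℝ} (ha : ∀ c, a c = 0 ∨ a c = 1)
    (hb : ∀ c, b c = 0 ∨ b c = 1) (hD : ∀ c, 0 ≤ D c)
    (h : ∀ c, b c = a c ∨ (1 ≤ D c ∧ a c ≠ b c) ∨ 2 ≤ D c)
    (hne : (∀ c, a c = a 0) → ∃ c, (1 ≤ D c ∧ a c ≠ b c) ∨ 2 ≤ D c) :
    2 ≤ ∑ c, (D c + 1 / 2 * ((a c - a (c + 1)) ^ 2 + (b c - b (c + 1)) ^ 2)) := by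
  have h2 : (2 : Fin 3) + 1 = 0 := rfl
  have h1 : (1 : Fin 3) + 1 = 2 := rfl
  simp only [Fin.forall_fin_succ, Fin.exists_fin_succ, Fin.sum_univ_three, h2, h1,
    zero_add] at *
  simp at *
  obtain ⟨a0, a1, a2⟩ := ha
  obtain ⟨b0, b1, b2⟩ := hb
  rcases a0 with a0 | a0 <;> rcases a1 with a1 | a1 <;> rcases a2 with a2 | a2 <;>
  rcases b0 with b0 | b0 <;> rcases b1 with b1 | b1 <;> rcases b2 with b2 | b2 <;>
  simp only [a0, a1, a2, b0, b1, b2] at * <;> norm_num at * <;> grind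

/-- Every cut separating two vertices of the prism has weight at least `2`. -/
theorem two_le_prismSum_cut [Fintype V] [DecidableEq V] {L : Fin 3 → ℕ} {p : Fin 3 → ℕ → V}
    (hp : ∀ g : V → ℝ, ∑ v, g v = ∑ c, ∑ t ∈ range (L c + 1), g (p c t))
    (s : V → ℝ) (hs : ∀ v, s v = 0 ∨ s v = 1) {v w : V} (hvw : s v ≠ s w) :
    2 ≤ prismSum L p (fun a b => (s a - s b) ^ 2) := by
  have hcover (v : V) : ∃ c, ∃ t ≤ L c, p c t = v := by
    by_contra! h
    have := hp (fun i => if i = v then 1 else 0)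
    rw [sum_eq_zero (s := univ (α := Fin 3)) fun c _ => sum_eq_zero fun t ht =>
      if_neg (h c t (Nat.lt_succ_iff.mp (mem_range.mp ht)))] at this
    simp at this
  have key (c : Fin 3) := sum_sq_sub_trichotomy (fun t => s (p c t)) (fun t => hs _) (L c)
  refine two_le_add_triangle_cut (fun c => hs _) (fun c => hs _)
    (fun c => sum_nonneg fun t _ => sq_nonneg _)
    (fun c => (key c).imp_left fun h => h _ le_rfl) fun ha => ?_
  by_contra hno
  have hconst (c : Fin 3) (t : ℕ) (ht : t ≤ L c) : s (p c t) = s (p 0 0) := by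
    rcases key c with h | h
    · exact (h t ht).trans (ha c)
    · exact (hno ⟨c, h⟩).elim
  obtain ⟨c, t, ht, rfl⟩ := hcover v
  obtain ⟨c', t', ht', rfl⟩ := hcover w
  exact hvw ((hconst c t ht).trans (hconst c' t' ht').symm)

theorem prismWeight_subtour [Fintype V] [DecidableEq V] {L : Fin 3 → ℕ} {p : Fin 3 → ℕ → V}
    (hp : ∀ g : V → ℝ, ∑ v, g v = ∑ c, ∑ t ∈ range (L c + 1), g (p c t))
    (S : Finset V) (hS : S.Nonempty) (hS' : S ≠ univ) :
    ∑ i ∈ S, ∑ j ∈ S, prismWeight L p i j ≤ 2 * ((S.card : ℝ) - 1) := by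
  let s : V → ℝ := fun v => if v ∈ S then 1 else 0
  obtain ⟨v, hv⟩ := hS
  obtain ⟨w, hw⟩ : ∃ w, w ∉ S := by
    by_contra! h
    exact hS' (eq_univ_iff_forall.mpr h)
  have hcut := two_le_prismSum_cut hp s (fun v => by by_cases h : v ∈ S <;> simp [s, h])
    (v := v) (w := w) (by simp [s, hv, hw])
  have hcard : ∑ v, s v = S.card := by simp [s]
  have hdeg := prismSum_endpoints hp s
  have hin := pairing_prismWeight L p (fun i j => s i * s j)
  have hsum : pairing (fun i j => s i * s j) (prismWeight L p) =
      ∑ i ∈ S, ∑ j ∈ S, prismWeight L p i j := by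
    simp [pairing_apply, s]
  have hsplit : prismSum L p (fun a b => (s a - s b) ^ 2) =
      prismSum L p (fun a b => s a + s b) - prismSum L p (fun a b => s a * s b + s b * s a) := by
    have hsq (a : V) : s a ^ 2 = s a := by by_cases h : a ∈ S <;> simp [s, h]
    simp only [prismSum, ← sum_sub_distrib]
    refine sum_congr rfl fun c _ => ?_
    have e (a b : V) : (s a - s b) ^ 2 = (s a + s b) - (s a * s b + s b * s a) := by
      rw [sub_sq, hsq, hsq]; ring
    simp only [e, sum_sub_distrib]
    ring
  rw [← hsum, hin]
  rw [hsplit, hdeg, hcard] at hcut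
  linarith

end Prism

theorem subtourLPFeasible_prismWeight {n : ℕ} (hn : 3 ≤ n) {L : Fin 3 → ℕ}
    {p : Fin 3 → ℕ → Fin n × Fin 3}
    (hp : ∀ g : Fin n × Fin 3 → ℝ, ∑ v, g v = ∑ c, ∑ t ∈ range (L c + 1), g (p c t)) :
    SubtourLPFeasible n (prismWeight L p) := by
  have hne (S : Finset (Fin n × Fin 3)) (hS : S.card ≤ 2) : S ≠ univ := by
    rintro rfl
    simp at hS
    omega
  have hdiag (i : Fin n × Fin 3) : prismWeight L p i i = 0 := by
    have h := prismWeight_subtour hp {i} (singleton_nonempty i) (hne _ (by simp))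
    simp at h
    exact le_antisymm h (prismWeight_nonneg L p i i)
  refine ⟨prismWeight_comm L p, hdiag, fun i j => ⟨prismWeight_nonneg L p i j, ?_⟩,
    sum_prismWeight hp, prismWeight_subtour hp⟩
  by_cases hij : i = j
  · rw [hij, hdiag]; exact zero_le_one
  · have h := prismWeight_subtour hp {i, j} (insert_nonempty _ _) (hne _ card_le_two)
    rw [card_pair hij, sum_pair hij, sum_pair hij, sum_pair hij, hdiag, hdiag,
      prismWeight_comm L p j i] at h
    norm_num at h
    linarith

/-- The point in column `t + 1` and row `r + 1` of the grid. -/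
def gridPoint (m t : ℕ) (r : Fin 3) : Fin (m + 3) × Fin 3 := (Fin.ofNat (m + 3) t, r)

/-- The lengths of the paths `gridPath m`. -/
def gridLength (m : ℕ) : Fin 3 → ℕ := ![m + 2, m, m + 4]

/-- The bottom row, the middle row without its ends, and the top row extended by these ends. -/
def gridPath (m : ℕ) : Fin 3 → ℕ → Fin (m + 3) × Fin 3 :=
  ![fun t => gridPoint m t 0, fun t => gridPoint m (t + 1) 1, fun t =>
    if t = 0 then gridPoint m 0 1 else if t = m + 4 then gridPoint m (m + 2) 1
    else gridPoint m (t - 1) 2]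

theorem sum_gridPoint (m : ℕ) (g : Fin (m + 3) × Fin 3 → ℝ) :
    ∑ v, g v = ∑ c, ∑ t ∈ range (gridLength m c + 1), g (gridPath m c t) := by
  have hrow (r : Fin 3) : ∑ i : Fin (m + 3), g (i, r) =
      ∑ t ∈ range (m + 3), g (gridPoint m t r) := by
    rw [← Fin.sum_univ_eq_sum_range (fun t => g (gridPoint m t r))]
    simp [gridPoint]
  have hlast : ∑ t ∈ range (m + 3), g (gridPath m 2 (t + 1)) =
      ∑ t ∈ range (m + 3), g (gridPoint m t 2) := by
    refine sum_congr rfl fun t ht => ?_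
    have : t ≠ m + 3 := (mem_range.mp ht).ne
    simp [gridPath, this]
  rw [Fintype.sum_prod_type_right, Fin.sum_univ_three, Fin.sum_univ_three, hrow, hrow, hrow]
  change _ = ∑ t ∈ range (m + 3), g (gridPoint m t 0) +
    ∑ t ∈ range (m + 1), g (gridPoint m (t + 1) 1) + ∑ t ∈ range (m + 5), g (gridPath m 2 t)
  rw [sum_range_succ' _ (m + 4), sum_range_succ _ (m + 3), hlast,
    sum_range_succ (fun t => g (gridPoint m t 1)), sum_range_succ' (fun t => g (gridPoint m t 1))]
  simp [gridPath]
  ring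

theorem lpValue_prismWeight (n : ℕ) (d : ℝ) (L : Fin 3 → ℕ) (p : Fin 3 → ℕ → Fin n × Fin 3) :
    lpValue n d (prismWeight L p) = prismSum L p (fun a b => eucl (pt n d a) (pt n d b)) := by
  have hcomm (a b : ℝ × ℝ) : eucl a b = eucl b a := by
    unfold eucl; congr 1; ring
  rw [lpValue, ← pairing_apply, pairing_prismWeight]
  have hdouble (a b : Fin n × Fin 3) : eucl (pt n d a) (pt n d b) + eucl (pt n d b) (pt n d a) =
      2 * eucl (pt n d a) (pt n d b) := by
    rw [hcomm (pt n d b)]; ring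
  simp only [prismSum, hdouble, ← mul_sum]
  rw [mul_sum]
  refine sum_congr rfl fun c _ => ?_
  ring

theorem eucl_gridPoint {m t t' : ℕ} (ht : t < m + 3) (ht' : t' < m + 3) (d : ℝ) (r r' : Fin 3) :
    eucl (pt (m + 3) d (gridPoint m t r)) (pt (m + 3) d (gridPoint m t' r')) =
      √(((t : ℝ) - t') ^ 2 + (((r.val : ℝ) - r'.val) * d) ^ 2) := by
  simp only [eucl, pt, gridPoint, Fin.ofNat, Nat.mod_eq_of_lt ht, Nat.mod_eq_of_lt ht']
  congr 1; ring

theorem lpValue_grid (m : ℕ) {d : ℝ} (hd : 0 < d) :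
    lpValue (m + 3) d (prismWeight (gridLength m) (gridPath m)) =
      3 * (m : ℝ) + 5 + 3 * d + √(d ^ 2 + 1) := by
  have hstep (r : Fin 3) {t : ℕ} (ht : t + 1 < m + 3) :
      eucl (pt (m + 3) d (gridPoint m t r)) (pt (m + 3) d (gridPoint m (t + 1) r)) = 1 := by
    rw [eucl_gridPoint (by omega) ht]
    simp
  have hrow0 : ∑ t ∈ range (m + 2), eucl (pt (m + 3) d (gridPath m 0 t))
      (pt (m + 3) d (gridPath m 0 (t + 1))) = m + 2 := by
    refine (sum_congr rfl fun t ht => hstep 0 (t := t) ?_).trans (by simp)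
    have := mem_range.mp ht
    omega
  have hrow1 : ∑ t ∈ range m, eucl (pt (m + 3) d (gridPath m 1 t))
      (pt (m + 3) d (gridPath m 1 (t + 1))) = m := by
    refine (sum_congr rfl fun t ht => hstep 1 (t := t + 1) ?_).trans (by simp)
    have := mem_range.mp ht
    omega
  have hzero : gridPath m 2 0 = gridPoint m 0 1 := by simp [gridPath]
  have hmid {t : ℕ} (ht : t < m + 3) : gridPath m 2 (t + 1) = gridPoint m t 2 := by
    simp [gridPath, ht.ne]
  have hend : gridPath m 2 (m + 4) = gridPoint m (m + 2) 1 := by simp [gridPath]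
  have hvert (t : ℕ) (ht : t < m + 3) (r r' : Fin 3) (hr : ((r.val : ℝ) - r'.val) ^ 2 = 1) :
      eucl (pt (m + 3) d (gridPoint m t r)) (pt (m + 3) d (gridPoint m t r')) = d := by
    rw [eucl_gridPoint ht ht, mul_pow, hr]
    simp [Real.sqrt_sq hd.le]
  have hrow2 : ∑ t ∈ range (m + 4), eucl (pt (m + 3) d (gridPath m 2 t))
      (pt (m + 3) d (gridPath m 2 (t + 1))) = m + 2 + 2 * d := by
    rw [sum_range_succ, sum_range_succ', hzero, hend, hmid (by omega), hmid (by omega),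
      hvert _ (by omega) _ _ (by norm_num), hvert _ (by omega) _ _ (by norm_num)]
    have hstep2 : ∀ t ∈ range (m + 2), eucl (pt (m + 3) d (gridPath m 2 (t + 1)))
        (pt (m + 3) d (gridPath m 2 (t + 1 + 1))) = 1 := fun t ht => by
      have := mem_range.mp ht
      rw [hmid (by omega), hmid (by omega)]
      exact hstep 2 (by omega)
    rw [sum_congr rfl hstep2]
    simp
    ring
  have hdiag {t t' : ℕ} (ht : t < m + 3) (ht' : t' < m + 3) (h : ((t : ℝ) - t') ^ 2 = 1) :
      eucl (pt (m + 3) d (gridPoint m t 0)) (pt (m + 3) d (gridPoint m t' 1)) = √(d ^ 2 + 1) := by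
    rw [eucl_gridPoint ht ht', h]
    congr 1
    norm_num
    ring
  have hback : eucl (pt (m + 3) d (gridPoint m 1 1)) (pt (m + 3) d (gridPoint m 0 1)) = 1 := by
    rw [eucl_gridPoint (by omega) (by omega)]
    simp
  have h2 : (2 : Fin 3) + 1 = 0 := rfl
  have h1 : (1 : Fin 3) + 1 = 2 := rfl
  have hp0 (t : ℕ) : gridPath m 0 t = gridPoint m t 0 := rfl
  have hp1 (t : ℕ) : gridPath m 1 t = gridPoint m (t + 1) 1 := rfl
  have hL0 : gridLength m 0 = m + 2 := rfl
  have hL1 : gridLength m 1 = m := rfl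
  have hL2 : gridLength m 2 = m + 4 := rfl
  rw [lpValue_prismWeight, prismSum, Fin.sum_univ_three, h2, h1, zero_add, hL0, hL1, hL2,
    hrow0, hrow1, hrow2]
  rw [hp0, hp0, hp1, hp1, hzero, hend, zero_add, hback, hstep 1 (by omega),
    hdiag (by omega) (by omega) (by norm_num),
    hdiag (by omega) (by omega) (by push_cast; ring),
    hvert 0 (by omega) _ _ (by norm_num), hvert (m + 2) (by omega) _ _ (by norm_num)]
  ring

/-- For `n ≥ 3` and `d > 0`, the optimum value of the subtour LP for `G(n,d)`
is at most `3n − 4 + 3d + √(d² + 1)`; in particular there is a feasible LP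
solution whose objective value equals this number. -/
theorem statement3 (n : ℕ) (hn : 3 ≤ n) (d : ℝ) (hd : 0 < d) :
    optLP n d ≤ 3 * (n : ℝ) - 4 + 3 * d + Real.sqrt (d ^ 2 + 1) ∧
    ∃ x, SubtourLPFeasible n x ∧
      lpValue n d x = 3 * (n : ℝ) - 4 + 3 * d + Real.sqrt (d ^ 2 + 1) := by
  have hfeas : ∃ x, SubtourLPFeasible n x ∧
      lpValue n d x = 3 * (n : ℝ) - 4 + 3 * d + Real.sqrt (d ^ 2 + 1) := by
    obtain ⟨m, rfl⟩ := Nat.exists_eq_add_of_le' hn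
    refine ⟨_, subtourLPFeasible_prismWeight hn (sum_gridPoint m), ?_⟩
    rw [lpValue_grid m hd]
    push_cast
    ring
  refine ⟨csInf_le ⟨0, ?_⟩ hfeas, hfeas⟩
  rintro _ ⟨x, hx, rfl⟩
  refine mul_nonneg (by norm_num) (sum_nonneg fun i _ => sum_nonneg fun j _ => ?_)
  exact mul_nonneg (Real.sqrt_nonneg _) (hx.2.2.1 i j).1

end
end

section
/- Let k ≥ 2 be an integer and d > 0 a real number. Then the minimum over integers a with 1 ≤ a ≤ k of the quantity (k − 2) + √((a−1)² + d²) + √((k−a−1)² + d²) equals k − 2 + √((k−2)² + 4d²) if k is even, and equals k − 2 + (1/2)·(√((k−1)² + 4d²) + √((k−3)² + 4d²)) if k is odd; the minimum is attained at a = ⌊k/2⌋. -/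
open Real Filter Finset

noncomputable section

theorem sqrt_sq_add_sq_convex (d x y s t : ℝ) (hs : 0 ≤ s) (ht : 0 ≤ t) :
    √((s * x + t * y) ^ 2 + ((s + t) * d) ^ 2) ≤ s * √(x ^ 2 + d ^ 2) + t * √(y ^ 2 + d ^ 2) := by
  have hx : √(x ^ 2 + d ^ 2) ^ 2 = x ^ 2 + d ^ 2 := Real.sq_sqrt (by positivity)
  have hy : √(y ^ 2 + d ^ 2) ^ 2 = y ^ 2 + d ^ 2 := Real.sq_sqrt (by positivity)
  have hxy : x * y + d ^ 2 ≤ √(x ^ 2 + d ^ 2) * √(y ^ 2 + d ^ 2) := by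
    rw [← Real.sqrt_mul (by positivity)]
    apply Real.le_sqrt_of_sq_le
    nlinarith [sq_nonneg (d * (x - y))]
  refine Real.sqrt_le_iff.mpr ⟨by positivity, ?_⟩
  have hst := mul_le_mul_of_nonneg_left hxy (mul_nonneg hs ht)
  linear_combination 2 * hst - s ^ 2 * hx - t ^ 2 * hy

/-- Moving two points towards each other with fixed sum does not increase the sum of the values of
the convex function `x ↦ √(x ^ 2 + d ^ 2)`. -/
theorem sqrt_sq_add_sq_add_le_of_mem_Icc {d x y u v : ℝ} (hxu : x ≤ u) (huy : u ≤ y)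
    (h : u + v = x + y) :
    √(u ^ 2 + d ^ 2) + √(v ^ 2 + d ^ 2) ≤ √(x ^ 2 + d ^ 2) + √(y ^ 2 + d ^ 2) := by
  obtain rfl | hlt := (hxu.trans huy).eq_or_lt
  · obtain rfl : u = x := le_antisymm huy hxu
    obtain rfl : v = u := by linarith
    rfl
  have hpos : 0 < y - x := sub_pos.mpr hlt
  have hs : 0 ≤ (y - u) / (y - x) := div_nonneg (by linarith) hpos.le
  have ht : 0 ≤ (u - x) / (y - x) := div_nonneg (by linarith) hpos.le
  have hst : (y - u) / (y - x) + (u - x) / (y - x) = 1 := by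
    field_simp
    ring
  have hu : (y - u) / (y - x) * x + (u - x) / (y - x) * y = u := by
    field_simp
    ring
  generalize (y - u) / (y - x) = s at *
  generalize (u - x) / (y - x) = t at *
  have hv : t * x + s * y = v := by linear_combination (x + y) * hst - hu - h
  have h₁ := sqrt_sq_add_sq_convex d x y s t hs ht
  have h₂ := sqrt_sq_add_sq_convex d x y t s ht hs
  rw [hu, hst, one_mul] at h₁
  rw [hv, add_comm t s, hst, one_mul] at h₂
  linear_combination h₁ + h₂ + (√(x ^ 2 + d ^ 2) + √(y ^ 2 + d ^ 2)) * hst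

theorem sqrt_two_mul_sq_add (d x : ℝ) :
    √((2 * x) ^ 2 + 4 * d ^ 2) = 2 * √(x ^ 2 + d ^ 2) := by
  rw [show (2 * x) ^ 2 + 4 * d ^ 2 = 2 ^ 2 * (x ^ 2 + d ^ 2) by ring,
    Real.sqrt_mul (by positivity), Real.sqrt_sq (by positivity)]

/-- For an integer `k ≥ 2` and `d > 0`, the minimum over integers `1 ≤ a ≤ k`
of `(k−2) + √((a−1)² + d²) + √((k−a−1)² + d²)` equals
`k − 2 + √((k−2)² + 4d²)` if `k` is even and
`k − 2 + (1/2)(√((k−1)² + 4d²) + √((k−3)² + 4d²))` if `k` is odd,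
and the minimum is attained at `a = ⌊k/2⌋`. -/
theorem statement5 (k : ℕ) (hk : 2 ≤ k) (d : ℝ) (hd : 0 < d) :
    IsLeast
      {v : ℝ | ∃ a : ℕ, 1 ≤ a ∧ a ≤ k ∧
        v = ((k : ℝ) - 2) + Real.sqrt (((a : ℝ) - 1) ^ 2 + d ^ 2) +
              Real.sqrt (((k : ℝ) - (a : ℝ) - 1) ^ 2 + d ^ 2)}
      (if Even k then
        (k : ℝ) - 2 + Real.sqrt (((k : ℝ) - 2) ^ 2 + 4 * d ^ 2)
       else
        (k : ℝ) - 2 + (1 / 2) * (Real.sqrt (((k : ℝ) - 1) ^ 2 + 4 * d ^ 2) +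
          Real.sqrt (((k : ℝ) - 3) ^ 2 + 4 * d ^ 2))) ∧
    ((k : ℝ) - 2) + Real.sqrt (((k / 2 : ℕ) - 1 : ℝ) ^ 2 + d ^ 2) +
        Real.sqrt (((k : ℝ) - ((k / 2 : ℕ) : ℝ) - 1) ^ 2 + d ^ 2) =
      (if Even k then
        (k : ℝ) - 2 + Real.sqrt (((k : ℝ) - 2) ^ 2 + 4 * d ^ 2)
       else
        (k : ℝ) - 2 + (1 / 2) * (Real.sqrt (((k : ℝ) - 1) ^ 2 + 4 * d ^ 2) +
          Real.sqrt (((k : ℝ) - 3) ^ 2 + 4 * d ^ 2))) := by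
  have key : ((k : ℝ) - 2) + Real.sqrt (((k / 2 : ℕ) - 1 : ℝ) ^ 2 + d ^ 2) +
        Real.sqrt (((k : ℝ) - ((k / 2 : ℕ) : ℝ) - 1) ^ 2 + d ^ 2) =
      (if Even k then
        (k : ℝ) - 2 + Real.sqrt (((k : ℝ) - 2) ^ 2 + 4 * d ^ 2)
       else
        (k : ℝ) - 2 + (1 / 2) * (Real.sqrt (((k : ℝ) - 1) ^ 2 + 4 * d ^ 2) +
          Real.sqrt (((k : ℝ) - 3) ^ 2 + 4 * d ^ 2))) := by
    split_ifs with he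
    · have hm : (k : ℝ) = 2 * (k / 2 : ℕ) := by
        exact_mod_cast (Nat.two_mul_div_two_of_even he).symm
      generalize k / 2 = m at *
      rw [hm, show (2 * (m : ℝ) - 2) = 2 * (m - 1) by ring, sqrt_two_mul_sq_add,
        show 2 * (m : ℝ) - m - 1 = m - 1 by ring]
      ring
    · have hm : (k : ℝ) = 2 * (k / 2 : ℕ) + 1 := by
        exact_mod_cast (Nat.two_mul_div_two_add_one_of_odd (Nat.not_even_iff_odd.mp he)).symm
      generalize k / 2 = m at *
      rw [hm, show (2 * (m : ℝ) + 1 - 1) = 2 * m by ring,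
        show (2 * (m : ℝ) + 1 - 3) = 2 * (m - 1) by ring, sqrt_two_mul_sq_add,
        sqrt_two_mul_sq_add, show 2 * (m : ℝ) + 1 - m - 1 = m by ring]
      ring
  refine ⟨?_, key⟩
  rw [← key]
  refine ⟨⟨k / 2, by omega, by omega, rfl⟩, ?_⟩
  rintro _ ⟨a, -, -, rfl⟩
  rw [add_assoc, add_assoc]
  refine add_le_add_right ?_ _
  rcases le_or_gt a (k / 2) with ha | ha
  · have h₁ : (a : ℝ) ≤ (k / 2 : ℕ) := by exact_mod_cast ha
    have h₂ : ((k / 2 : ℕ) : ℝ) + a ≤ k := by exact_mod_cast (by omega : k / 2 + a ≤ k)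
    exact sqrt_sq_add_sq_add_le_of_mem_Icc (by linarith) (by linarith) (by ring)
  · have h₁ : ((k / 2 : ℕ) : ℝ) ≤ a := by exact_mod_cast ha.le
    have h₂ : (k : ℝ) ≤ (k / 2 : ℕ) + a := by exact_mod_cast (by omega : k ≤ k / 2 + a)
    rw [add_comm √(((a : ℝ) - 1) ^ 2 + d ^ 2)]
    exact sqrt_sq_add_sq_add_le_of_mem_Icc (by linarith) (by linarith) (by ring)

end
end
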